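/- Let F be a hereditary and spreading family on ℕ and, for u ∈ F, put I_u = { i ∈ ℕ : {i} ∪ u ∉ F }. Then for all n, k ∈ ℕ the family F_{n,k} = { s ∈ F : |s| = n and |I_s| ≤ k } is spreading: every spread of a member of F_{n,k} belongs to F_{n,k}. -/

import Mathlib

open scoped Classical

noncomputable section

/-- Characteristic function of a finite set, as an element of the Cantor cube `2^ι`. -/
def chi {ι : Type*} (s : Finset ι) : ι → Bool := fun a => decide (a ∈ s)

/-- The copy of a collection of finite sets inside the Cantor cube `2^ι`. -/
def chiImg {ι : Type*} (F : Set (Finset ι)) : Set (ι → Bool) := chi '' F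

/-- `F` is a family: it contains the empty set and all singletons. -/
def IsFam {ι : Type*} (F : Set (Finset ι)) : Prop := ∅ ∈ F ∧ ∀ a : ι, {a} ∈ F

/-- `F` is hereditary: it is closed under subsets. -/
def IsHereditary {ι : Type*} (F : Set (Finset ι)) : Prop :=
  ∀ ⦃s t : Finset ι⦄, s ⊆ t → t ∈ F → s ∈ F

/-- `F` is compact: its copy in the Cantor cube `2^ι` is closed
(equivalently, compact). -/
def IsCompactFam {ι : Type*} (F : Set (Finset ι)) : Prop := IsClosed (chiImg F)

/-- The set of maximal elements of `F` with respect to inclusion. -/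
def famMAX {ι : Type*} (F : Set (Finset ι)) : Set (Finset ι) :=
  {s ∈ F | ∀ t ∈ F, s ⊆ t → s = t}

/-- The image `{π[s] : s ∈ F}` of a collection of finite sets under a permutation of the
index set. -/
def permImg {ι : Type*} (π : Equiv.Perm ι) (F : Set (Finset ι)) : Set (Finset ι) :=
  (fun s => Finset.image π s) '' F

/-- `t` is a spread of `s`: there is an injection `σ` of `s` into the index set with
`σ i ≥ i` for every `i ∈ s`, whose image is `t`. -/
def IsSpread {ι : Type*} [LinearOrder ι] (s t : Finset ι) : Prop :=
  ∃ σ : ι → ι, Set.InjOn σ ↑s ∧ (∀ i ∈ s, i ≤ σ i) ∧ t = Finset.image σ s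

/-- `F` is spreading: it contains every spread of each of its members. -/
def IsSpreading {ι : Type*} [LinearOrder ι] (F : Set (Finset ι)) : Prop :=
  ∀ s ∈ F, ∀ t, IsSpread s t → t ∈ F

/-- Moving one element of a member of a spreading family upwards does not enlarge the
set of points that cannot be added to it. -/
theorem IsSpreading.encard_insert_erase_le {F : Set (Finset ℕ)} (hs : IsSpreading F)
    {s : Finset ℕ} (hsF : s ∈ F) {a b : ℕ} (ha : a ∈ s) (hb : b ∉ s) (hab : a ≤ b) :
    insert b (s.erase a) ∈ F ∧
      {i : ℕ | insert i (insert b (s.erase a)) ∉ F}.encard ≤ {i : ℕ | insert i s ∉ F}.encard := by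
  have key : ∀ u : Finset ℕ, u ∈ F → b ∉ u → u.image (Equiv.swap a b) ∈ F := by
    intro u hu hbu
    refine hs u hu _ ⟨Equiv.swap a b, (Equiv.injective _).injOn, fun i hi => ?_, rfl⟩
    have hib : i ≠ b := fun h => hbu (h ▸ hi)
    by_cases hia : i = a
    · simpa [hia] using hab
    · rw [Equiv.swap_apply_of_ne_of_ne hia hib]
  have himg : s.image (Equiv.swap a b) = insert b (s.erase a) := by
    ext x
    simp only [Finset.mem_image, Finset.mem_insert, Finset.mem_erase]
    constructor
    · rintro ⟨i, hi, rfl⟩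
      rw [Equiv.swap_apply_def]
      grind
    · rintro (rfl | ⟨hx, hxs⟩)
      · exact ⟨a, ha, by simp⟩
      · exact ⟨x, hxs, Equiv.swap_apply_of_ne_of_ne hx (fun h => hb (h ▸ hxs))⟩
  have htF : insert b (s.erase a) ∈ F := himg ▸ key s hsF hb
  refine ⟨htF, ?_⟩
  rw [← (Equiv.injective (Equiv.swap a b)).encard_image {i : ℕ | insert i s ∉ F}]
  refine Set.encard_le_encard fun j hj => ⟨Equiv.swap a b j, fun hmem => hj ?_, by simp⟩
  by_cases hja : j = a
  · subst hja
    rw [Finset.insert_comm, Finset.insert_erase ha]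
    simpa using hmem
  by_cases hjb : j = b
  · subst hjb
    simpa using htF
  rw [Equiv.swap_apply_of_ne_of_ne hja hjb] at hmem
  have h := key _ hmem (by simp [hb, Ne.symm hjb])
  rwa [Finset.image_insert, Equiv.swap_apply_of_ne_of_ne hja hjb, himg] at h

/-- Spreading a member of a spreading family does not increase the number of points that cannot
be added to it. -/
theorem IsSpreading.encard_image_le {F : Set (Finset ℕ)} (hs : IsSpreading F)
    {s : Finset ℕ} (hsF : s ∈ F) {σ : ℕ → ℕ} (hinj : Set.InjOn σ ↑s) (hle : ∀ i ∈ s, i ≤ σ i) :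
    {i : ℕ | insert i (s.image σ) ∉ F}.encard ≤ {i : ℕ | insert i s ∉ F}.encard := by
  induction hm : (s.filter fun i => σ i ≠ i).card using Nat.strong_induction_on
    generalizing s σ with
  | _ m ih =>
  rcases (s.filter fun i => σ i ≠ i).eq_empty_or_nonempty with he | hne
  · have hfix : ∀ i ∈ s, σ i = i := by simpa [Finset.filter_eq_empty_iff] using he
    rw [Finset.image_congr (g := id) hfix, Finset.image_id]
  obtain ⟨a, haf, hmax⟩ := (s.filter fun i => σ i ≠ i).exists_max_image id hne
  obtain ⟨ha, hne_a⟩ := Finset.mem_filter.1 haf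
  have hb : σ a ∉ s := by
    intro hb
    have hlt : a < σ a := lt_of_le_of_ne (hle a ha) (Ne.symm hne_a)
    by_cases hfix : σ (σ a) = σ a
    · exact hne_a (hinj hb ha hfix)
    · exact absurd (hmax _ (Finset.mem_filter.2 ⟨hb, hfix⟩)) (not_le.2 hlt)
  obtain ⟨htF, hcard⟩ := hs.encard_insert_erase_le hsF ha hb (hle a ha)
  have hupd : ∀ i ∈ s, Function.update σ (σ a) (σ a) i = σ i := fun i hi =>
    Function.update_of_ne (ne_of_mem_of_not_mem hi hb) _ _
  have himg : (insert (σ a) (s.erase a)).image (Function.update σ (σ a) (σ a)) = s.image σ := by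
    rw [Finset.image_insert, Function.update_self,
      Finset.image_congr (g := σ) fun i hi => hupd i (Finset.mem_of_mem_erase hi),
      ← Finset.image_insert, Finset.insert_erase ha]
  rw [← himg]
  refine le_trans (ih _ ?_ htF ?_ ?_ rfl) hcard
  · rw [← hm]
    refine Finset.card_lt_card (Finset.ssubset_iff_subset_ne.2 ⟨fun i hi => ?_, fun h => ?_⟩)
    · have := hupd i
      simp only [Finset.mem_filter, Finset.mem_insert, Finset.mem_erase] at hi ⊢
      grind
    · have := h ▸ haf
      simp only [Finset.mem_filter, Finset.mem_insert, Finset.mem_erase] at this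
      grind
  · refine Finset.card_image_iff.1 ?_
    rw [himg, Finset.card_image_of_injOn hinj,
      Finset.card_insert_of_notMem fun h => hb (Finset.mem_of_mem_erase h),
      Finset.card_erase_add_one ha]
  · intro i hi
    rcases Finset.mem_insert.1 hi with rfl | hi
    · simp
    · have his := Finset.mem_of_mem_erase hi
      rw [hupd i his]
      exact hle i his

/-- Let `F` be a hereditary spreading family on `ℕ` and, for `u ∈ F`, put
`I_u = {i : {i} ∪ u ∉ F}`. Then for all `n, k` the family
`F_{n,k} = {s ∈ F : |s| = n ∧ |I_s| ≤ k}` is spreading. -/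
theorem statement11 (F : Set (Finset ℕ))
    (hfam : IsFam F) (hh : IsHereditary F) (hs : IsSpreading F) (n k : ℕ) :
    ∀ s ∈ {u : Finset ℕ | u ∈ F ∧ u.card = n ∧ {i : ℕ | insert i u ∉ F}.encard ≤ (k : ℕ∞)},
      ∀ t, IsSpread s t →
        t ∈ {u : Finset ℕ | u ∈ F ∧ u.card = n ∧
          {i : ℕ | insert i u ∉ F}.encard ≤ (k : ℕ∞)} := by
  rintro s ⟨hsF, hcard, hk⟩ t ⟨σ, hinj, hle, rfl⟩
  exact ⟨hs s hsF _ ⟨σ, hinj, hle, rfl⟩, (Finset.card_image_of_injOn hinj).trans hcard,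
    (hs.encard_image_le hsF hinj hle).trans hk⟩
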